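/- arXiv:2310.01713 — 2 statements merged into one kernel-verified Lean document; each statement's English description precedes it below -/
import Mathlib

section
/- Local maximum principle of the scalar greedy scheme (Theorem 4.3, assertion (4.6)): fix i ∈ 𝒱, let k_i ∈ (U_i^{min,n}, U_i^{max,n}) (where U_i^{min,n} := min over j with c_{ij} ≠ 0 or j = i of U_j^n, and U_i^{max,n} the corresponding max), and for j ≠ i with c_{ij} ≠ 0 set λ_{ij} := max(λ_ε, λ(k_i, c_{ij}/‖c_{ij}‖, U_i^n, U_j^n)) and d_{ij} := max(λ_{ij}‖c_{ij}‖, λ_{ji}‖c_{ji}‖); set d_{ij} := 0 when c_{ij} = 0. If 1 − (2τ/m_i) ∑_{j≠i} d_{ij} ≥ 0, then the update satisfies U_i^{n+1} ∈ [U_i^{min,n}, U_i^{max,n}]. -/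
open Finset Matrix

/-- The Euclidean (ℓ²) norm of a vector of `ℝ^d`. -/
noncomputable def l2norm {d : ℕ} (x : Fin d → ℝ) : ℝ := Real.sqrt (x ⬝ᵥ x)

/-- The (Roe) wave speed `λ₁₂`. -/
noncomputable def lam12 {d : ℕ} (f : ℝ → Fin d → ℝ) (n : Fin d → ℝ)
    (uL uR : ℝ) : ℝ :=
  if uR ≠ uL then |(f uR - f uL) ⬝ᵥ n| / |uR - uL|
  else max |deriv f uL ⬝ᵥ n| |deriv f uR ⬝ᵥ n|

/-- The Kružkov entropy `η_k(u) := |u - k|`. -/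
noncomputable def kruzEta (k u : ℝ) : ℝ := |u - k|

/-- The Kružkov entropy flux `q_k(u) := sign(u - k)(f(u) - f(k))`. -/
noncomputable def kruzQ {d : ℕ} (f : ℝ → Fin d → ℝ) (k u : ℝ) : Fin d → ℝ :=
  Real.sign (u - k) • (f u - f k)

/-- The entropy wave speed `λ(k, n, u_L, u_R)` of Lemma 4.2. -/
noncomputable def lamK {d : ℕ} (f : ℝ → Fin d → ℝ) (k : ℝ) (n : Fin d → ℝ)
    (uL uR : ℝ) : ℝ :=
  if k ∈ Set.Ioo (min uL uR) (max uL uR) then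
    max (max
      ((((kruzQ f k uR - kruzQ f k uL) ⬝ᵥ n) + (f uR - f uL) ⬝ᵥ n)
        / ((kruzEta k uL + kruzEta k uR) + (uL + uR - 2*k)))
      ((((kruzQ f k uR - kruzQ f k uL) ⬝ᵥ n) - (f uR - f uL) ⬝ᵥ n)
        / ((kruzEta k uL + kruzEta k uR) - (uL + uR - 2*k))))
      (lam12 f n uL uR)
  else lam12 f n uL uR

theorem l2norm_pos {d : ℕ} {x : Fin d → ℝ} (hx : x ≠ 0) : 0 < l2norm x := by
  refine Real.sqrt_pos.2 (lt_of_le_of_ne ?_ fun h => hx (dotProduct_self_eq_zero.1 h.symm))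
  exact Finset.sum_nonneg fun a _ => mul_self_nonneg (x a)

theorem lam12_le_lamK {d : ℕ} (f : ℝ → Fin d → ℝ) (k : ℝ) (n : Fin d → ℝ) (uL uR : ℝ) :
    lam12 f n uL uR ≤ lamK f k n uL uR := by
  unfold lamK
  split_ifs
  · exact le_max_right _ _
  · exact le_rfl

/-- The flux difference along `v` is controlled by the wave speed in the direction of `v`. -/
theorem abs_flux_sub_dotProduct_le {d : ℕ} (f : ℝ → Fin d → ℝ) (k : ℝ) {v : Fin d → ℝ}
    (hv : v ≠ 0) (uL uR : ℝ) :
    |(f uR - f uL) ⬝ᵥ v| ≤ lamK f k ((l2norm v)⁻¹ • v) uL uR * l2norm v * |uR - uL| := by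
  by_cases h : uR = uL
  · simp [h]
  have hpos := l2norm_pos hv
  have hu : 0 < |uR - uL| := abs_pos.2 (sub_ne_zero.2 h)
  have heq : lam12 f ((l2norm v)⁻¹ • v) uL uR * l2norm v * |uR - uL|
      = |(f uR - f uL) ⬝ᵥ v| := by
    rw [lam12, if_pos h, dotProduct_smul, smul_eq_mul, abs_mul, abs_of_pos (inv_pos.2 hpos)]
    field_simp
  rw [← heq]
  gcongr
  exact lam12_le_lamK f k _ uL uR

/-- An explicit update with viscosity dominating the fluxes stays below any upper bound of the
states involved, under the CFL condition. -/
theorem update_le_of_viscosity {ι : Type*} (s : Finset ι) {D G U : ι → ℝ} {u M r : ℝ}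
    (hr : 0 ≤ r) (hu : u ≤ M) (hD : ∀ j ∈ s, 0 ≤ D j) (hU : ∀ j ∈ s, D j ≠ 0 → U j ≤ M)
    (hG : ∀ j ∈ s, |G j| ≤ D j * |U j - u|) (hcfl : 2 * r * ∑ j ∈ s, D j ≤ 1) :
    u - r * (∑ j ∈ s, G j - ∑ j ∈ s, D j * (U j - u)) ≤ M := by
  have key : ∑ j ∈ s, D j * (U j - u) - ∑ j ∈ s, G j ≤ (∑ j ∈ s, D j) * (2 * (M - u)) := by
    rw [← Finset.sum_sub_distrib, Finset.sum_mul]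
    refine Finset.sum_le_sum fun j hj => ?_
    have hg := (abs_le.1 (hG j hj)).1
    rcases (hD j hj).eq_or_lt with h0 | h0
    · rw [← h0] at hg ⊢
      linarith
    · have hM := hU j hj h0.ne'
      rcases abs_cases (U j - u) with ⟨h, _⟩ | ⟨h, _⟩ <;> rw [h] at hg <;> nlinarith
  have h1 := mul_le_mul_of_nonneg_left key hr
  have h2 := mul_le_mul_of_nonneg_right hcfl (sub_nonneg.2 hu)
  linarith

/-- Local maximum principle of the scalar greedy scheme (Theorem 4.3,
assertion (4.6)): with the greedy viscosity built from the wave speeds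
`λ_{ij} := max(λ_ε, λ(k_i, c_{ij}/‖c_{ij}‖, U_i, U_j))` and under the CFL
condition, the update satisfies `U_i^{n+1} ∈ [U_i^{min,n}, U_i^{max,n}]`. -/
theorem scalar_greedy_max_principle {d : ℕ} {ι : Type*} [Fintype ι] [DecidableEq ι]
    (mass : ι → ℝ) (hmass : ∀ i, 0 < mass i)
    (c : ι → ι → Fin d → ℝ) (hcanti : ∀ i j, c i j = -c j i)
    (hcsum : ∀ i, ∑ j, c i j = 0)
    (f : ℝ → Fin d → ℝ) (hf : Differentiable ℝ f)
    (τ : ℝ) (hτ : 0 < τ) (lamEps : ℝ) (hlamEps : 0 < lamEps)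
    (Un : ι → ℝ) (k : ι → ℝ) (i : ι)
    (Umin Umax : ℝ)
    (hUmin : Umin = (Finset.univ.filter (fun j => c i j ≠ 0 ∨ j = i)).inf'
      ⟨i, by simp⟩ Un)
    (hUmax : Umax = (Finset.univ.filter (fun j => c i j ≠ 0 ∨ j = i)).sup'
      ⟨i, by simp⟩ Un)
    (hki : k i ∈ Set.Ioo Umin Umax)
    (lam : ι → ι → ℝ)
    (hlam : ∀ a b : ι, lam a b
      = max lamEps (lamK f (k a) ((l2norm (c a b))⁻¹ • c a b) (Un a) (Un b)))
    (dvisc : ι → ι → ℝ)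
    (hdvisc : ∀ j : ι, dvisc i j = if c i j = 0 then 0
      else max (lam i j * l2norm (c i j)) (lam j i * l2norm (c j i)))
    (hcfl : 0 ≤ 1 - (2 * τ / mass i) * ∑ j ∈ Finset.univ.erase i, dvisc i j)
    (Unext : ℝ)
    (hUnext : Unext = Un i - (τ / mass i) * ((∑ j, f (Un j) ⬝ᵥ c i j)
      - ∑ j ∈ Finset.univ.erase i, dvisc i j * (Un j - Un i))) :
    Unext ∈ Set.Icc Umin Umax := by
  have hcii : c i i = 0 := self_eq_neg.1 (hcanti i i)
  have hflux : ∑ j, f (Un j) ⬝ᵥ c i j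
      = ∑ j ∈ Finset.univ.erase i, (f (Un j) - f (Un i)) ⬝ᵥ c i j := by
    have h0 : ∑ j, f (Un i) ⬝ᵥ c i j = 0 := by
      rw [← dotProduct_sum, hcsum, dotProduct_zero]
    rw [Finset.sum_erase _ (by simp), ← sub_zero (∑ j, f (Un j) ⬝ᵥ c i j), ← h0,
      ← Finset.sum_sub_distrib]
    simp only [sub_dotProduct]
  have hD : ∀ j, 0 ≤ dvisc i j := fun j => by
    rw [hdvisc]
    split_ifs
    · exact le_rfl
    · refine le_max_of_le_left (mul_nonneg ?_ (Real.sqrt_nonneg _))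
      rw [hlam]
      exact le_max_of_le_left hlamEps.le
  have hG : ∀ j, |(f (Un j) - f (Un i)) ⬝ᵥ c i j| ≤ dvisc i j * |Un j - Un i| := fun j => by
    by_cases hc : c i j = 0
    · simp [hc, hdvisc]
    · refine (abs_flux_sub_dotProduct_le f (k i) hc _ _).trans ?_
      rw [hdvisc, if_neg hc]
      gcongr
      refine le_max_of_le_left ?_
      rw [hlam]
      exact mul_le_mul_of_nonneg_right (le_max_right _ _) (Real.sqrt_nonneg _)
  have hmem : ∀ j, dvisc i j ≠ 0 → c i j ≠ 0 ∨ j = i := fun j hj =>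
    Or.inl fun hc => hj (by rw [hdvisc, if_pos hc])
  have hmin : ∀ j, c i j ≠ 0 ∨ j = i → Umin ≤ Un j := fun j hj => by
    rw [hUmin]
    exact Finset.inf'_le _ (by simpa using hj)
  have hmax : ∀ j, c i j ≠ 0 ∨ j = i → Un j ≤ Umax := fun j hj => by
    rw [hUmax]
    exact Finset.le_sup' _ (by simpa using hj)
  have hr : 0 ≤ τ / mass i := (div_pos hτ (hmass i)).le
  have hcfl' : 2 * (τ / mass i) * ∑ j ∈ Finset.univ.erase i, dvisc i j ≤ 1 := by
    rw [← mul_div_assoc]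
    linarith
  rw [hUnext, hflux]
  constructor
  · have h := update_le_of_viscosity (Finset.univ.erase i) (D := dvisc i)
      (G := fun j => -((f (Un j) - f (Un i)) ⬝ᵥ c i j)) (U := fun j => -Un j)
      (u := -Un i) (M := -Umin) hr (neg_le_neg (hmin i (Or.inr rfl))) (fun j _ => hD j)
      (fun j _ hj => neg_le_neg (hmin j (hmem j hj)))
      (fun j _ => by
        rw [abs_neg, neg_sub_neg, abs_sub_comm]
        exact hG j)
      hcfl'
    have hneg : ∑ j ∈ Finset.univ.erase i, dvisc i j * (-Un j - -Un i)
        = -∑ j ∈ Finset.univ.erase i, dvisc i j * (Un j - Un i) := by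
      rw [← Finset.sum_neg_distrib]
      exact Finset.sum_congr rfl fun j _ => by ring
    rw [hneg, Finset.sum_neg_distrib] at h
    linarith
  · exact update_le_of_viscosity _ hr (hmax i (Or.inr rfl)) (fun j _ => hD j)
      (fun j _ hj => hmax j (hmem j hj)) (fun j _ => hG j) hcfl'
end

section
/- Discrete Kružkov entropy inequality of the scalar greedy scheme (Theorem 4.3, assertion (4.7)): under the same hypotheses (k_i ∈ (U_i^{min,n}, U_i^{max,n}), greedy viscosity d_{ij} := max(λ_{ij}‖c_{ij}‖, λ_{ji}‖c_{ji}‖) with λ_{ij} := max(λ_ε, λ(k_i, c_{ij}/‖c_{ij}‖, U_i^n, U_j^n)) for c_{ij} ≠ 0 and d_{ij} := 0 otherwise, and CFL condition 1 − (2τ/m_i) ∑_{j≠i} d_{ij} ≥ 0), the update satisfies (m_i/τ)(η_{k_i}(U_i^{n+1}) − η_{k_i}(U_i^n)) + ∑_{j∈𝒱} c_{ij}·q_{k_i}(U_j^n) − ∑_{j≠i} d_{ij}(η_{k_i}(U_j^n) − η_{k_i}(U_i^n)) ≤ 0. -/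
open Finset Matrix

/-- Any speed above `lam12` controls the flux difference across `[uL, uR]`. -/
theorem abs_flux_sub_le_of_lam12_le {d : ℕ} (f : ℝ → Fin d → ℝ) (n : Fin d → ℝ)
    {uL uR l : ℝ} (h : lam12 f n uL uR ≤ l) :
    |(f uR - f uL) ⬝ᵥ n| ≤ l * |uR - uL| := by
  rcases eq_or_ne uR uL with rfl | hne
  · simp
  · rw [lam12, if_pos hne] at h
    exact (div_le_iff₀ (abs_pos.mpr (sub_ne_zero.mpr hne))).mp h

/-- To the right of `k` the Kružkov flux is the flux relative to `k`. -/
theorem kruzQ_of_le {d : ℕ} (f : ℝ → Fin d → ℝ) {k u : ℝ} (h : k ≤ u) :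
    kruzQ f k u = f u - f k := by
  rcases h.eq_or_lt with rfl | h
  · simp [kruzQ]
  · simp [kruzQ, Real.sign_of_pos (sub_pos.mpr h)]

/-- To the left of `k` the Kružkov flux is the opposite of the flux relative to `k`. -/
theorem kruzQ_of_ge {d : ℕ} (f : ℝ → Fin d → ℝ) {k u : ℝ} (h : u ≤ k) :
    kruzQ f k u = f k - f u := by
  rcases h.eq_or_lt with rfl | h
  · simp [kruzQ]
  · simp [kruzQ, Real.sign_of_neg (sub_neg.mpr h)]

/-- The entropy inequality for the bar state of a Riemann problem, multiplied by twice the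
speed `l`. -/
theorem abs_bar_state_le_of_lamK_le {d : ℕ} (f : ℝ → Fin d → ℝ) (k : ℝ) (n : Fin d → ℝ)
    {uL uR l : ℝ} (hl : 0 ≤ l) (h : lamK f k n uL uR ≤ l) :
    |l * (uL + uR - 2 * k) - (f uR - f uL) ⬝ᵥ n|
      ≤ l * (kruzEta k uL + kruzEta k uR) - (kruzQ f k uR - kruzQ f k uL) ⬝ᵥ n := by
  unfold lamK at h
  split_ifs at h with hk
  · simp only [max_le_iff] at h
    obtain ⟨⟨h₁, h₂⟩, -⟩ := h
    have hpos : 0 < kruzEta k uL + kruzEta k uR + (uL + uR - 2 * k) ∧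
        0 < kruzEta k uL + kruzEta k uR - (uL + uR - 2 * k) := by
      obtain ⟨hmin, hmax⟩ := hk
      unfold kruzEta
      have hL := le_abs_self (uL - k)
      have hL' := neg_le_abs (uL - k)
      have hR := le_abs_self (uR - k)
      have hR' := neg_le_abs (uR - k)
      rcases min_lt_iff.mp hmin with h | h <;> rcases lt_max_iff.mp hmax with h' | h' <;>
        constructor <;> linarith
    rw [div_le_iff₀ hpos.1] at h₁
    rw [div_le_iff₀ hpos.2] at h₂
    rw [abs_le]
    constructor <;> linarith
  · have hB := abs_le.mp (abs_flux_sub_le_of_lam12_le f n h)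
    have hside : (k ≤ uL ∧ k ≤ uR) ∨ (uL ≤ k ∧ uR ≤ k) := by
      rw [Set.mem_Ioo, not_and_or, not_lt, not_lt, le_min_iff, max_le_iff] at hk
      exact hk
    rcases hside with ⟨hL, hR⟩ | ⟨hL, hR⟩
    · have hdist : l * |uR - uL| ≤ l * (uL + uR - 2 * k) :=
        mul_le_mul_of_nonneg_left (abs_le.mpr ⟨by linarith, by linarith⟩) hl
      rw [kruzQ_of_le f hL, kruzQ_of_le f hR, kruzEta, kruzEta, abs_of_nonneg (sub_nonneg.mpr hL),
        abs_of_nonneg (sub_nonneg.mpr hR), sub_sub_sub_cancel_right, abs_of_nonneg (by linarith)]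
      linarith
    · have hdist : l * |uR - uL| ≤ l * (2 * k - uL - uR) :=
        mul_le_mul_of_nonneg_left (abs_le.mpr ⟨by linarith, by linarith⟩) hl
      rw [kruzQ_of_ge f hL, kruzQ_of_ge f hR, kruzEta, kruzEta, abs_of_nonpos (sub_nonpos.mpr hL),
        abs_of_nonpos (sub_nonpos.mpr hR), sub_sub_sub_cancel_left, abs_of_nonpos (by linarith),
        ← neg_sub (f uR), neg_dotProduct]
      linarith

/-- The bar state entropy inequality for an unnormalized direction `v` and a viscosity `D`. -/
theorem abs_bar_state_le_of_lamK_mul_le {d : ℕ} (f : ℝ → Fin d → ℝ) (k : ℝ) {v : Fin d → ℝ}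
    (hv : v ≠ 0) {uL uR D : ℝ} (hD : 0 ≤ D)
    (h : lamK f k ((l2norm v)⁻¹ • v) uL uR * l2norm v ≤ D) :
    |D * (uL + uR - 2 * k) - (f uR - f uL) ⬝ᵥ v|
      ≤ D * (kruzEta k uL + kruzEta k uR) - (kruzQ f k uR - kruzQ f k uL) ⬝ᵥ v := by
  have hpos : 0 < l2norm v := by
    refine Real.sqrt_pos.mpr (lt_of_le_of_ne ?_ fun h => hv (dotProduct_self_eq_zero.mp h.symm))
    exact Finset.sum_nonneg fun j _ => mul_self_nonneg (v j)
  have key := mul_le_mul_of_nonneg_left (abs_bar_state_le_of_lamK_le f k ((l2norm v)⁻¹ • v)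
    (div_nonneg hD hpos.le) ((le_div_iff₀ hpos).mpr h)) hpos.le
  rw [← abs_of_pos hpos, ← abs_mul, abs_of_pos hpos, dotProduct_smul, dotProduct_smul,
    smul_eq_mul, smul_eq_mul, mul_sub (l2norm v), mul_sub (l2norm v)] at key
  simpa only [← mul_assoc (l2norm v) (D / l2norm v),
    mul_div_cancel₀ D hpos.ne', mul_inv_cancel_left₀ hpos.ne'] using key

/-- Against coefficients that sum to zero, only differences with the value
at `i` contribute. -/
theorem sum_dotProduct_eq_sum_erase_sub {d : ℕ} {ι : Type*} [Fintype ι] [DecidableEq ι]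
    {v : ι → Fin d → ℝ} (hv : ∑ j, v j = 0) (g : ι → Fin d → ℝ) (i : ι) :
    ∑ j, g j ⬝ᵥ v j = ∑ j ∈ Finset.univ.erase i, (g j - g i) ⬝ᵥ v j := by
  rw [Finset.sum_erase _ (by simp)]
  simp only [sub_dotProduct, Finset.sum_sub_distrib, ← dotProduct_sum, hv, dotProduct_zero,
    sub_zero]

/-- Discrete Kružkov entropy inequality of the scalar greedy scheme
(Theorem 4.3, assertion (4.7)): with the greedy viscosity built from the
wave speeds `λ_{ij} := max(λ_ε, λ(k_i, c_{ij}/‖c_{ij}‖, U_i, U_j))` and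
under the CFL condition, the update satisfies the discrete Kružkov
entropy inequality for the entropy pair `(η_{k_i}, q_{k_i})`. -/
theorem scalar_greedy_entropy_inequality {d : ℕ} {ι : Type*} [Fintype ι] [DecidableEq ι]
    (mass : ι → ℝ) (hmass : ∀ i, 0 < mass i)
    (c : ι → ι → Fin d → ℝ) (hcanti : ∀ i j, c i j = -c j i)
    (hcsum : ∀ i, ∑ j, c i j = 0)
    (f : ℝ → Fin d → ℝ) (hf : Differentiable ℝ f)
    (τ : ℝ) (hτ : 0 < τ) (lamEps : ℝ) (hlamEps : 0 < lamEps)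
    (Un : ι → ℝ) (k : ι → ℝ) (i : ι)
    (Umin Umax : ℝ)
    (hUmin : Umin = (Finset.univ.filter (fun j => c i j ≠ 0 ∨ j = i)).inf'
      ⟨i, by simp⟩ Un)
    (hUmax : Umax = (Finset.univ.filter (fun j => c i j ≠ 0 ∨ j = i)).sup'
      ⟨i, by simp⟩ Un)
    (hki : k i ∈ Set.Ioo Umin Umax)
    (lam : ι → ι → ℝ)
    (hlam : ∀ a b : ι, lam a b
      = max lamEps (lamK f (k a) ((l2norm (c a b))⁻¹ • c a b) (Un a) (Un b)))
    (dvisc : ι → ι → ℝ)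
    (hdvisc : ∀ j : ι, dvisc i j = if c i j = 0 then 0
      else max (lam i j * l2norm (c i j)) (lam j i * l2norm (c j i)))
    (hcfl : 0 ≤ 1 - (2 * τ / mass i) * ∑ j ∈ Finset.univ.erase i, dvisc i j)
    (Unext : ℝ)
    (hUnext : Unext = Un i - (τ / mass i) * ((∑ j, f (Un j) ⬝ᵥ c i j)
      - ∑ j ∈ Finset.univ.erase i, dvisc i j * (Un j - Un i))) :
    mass i / τ * (kruzEta (k i) Unext - kruzEta (k i) (Un i))
      + ∑ j, c i j ⬝ᵥ kruzQ f (k i) (Un j)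
      - ∑ j ∈ Finset.univ.erase i,
          dvisc i j * (kruzEta (k i) (Un j) - kruzEta (k i) (Un i)) ≤ 0 := by
  have hσ : 0 < τ / mass i := div_pos hτ (hmass i)
  have hbar : ∀ j, |dvisc i j * (Un i + Un j - 2 * k i) - (f (Un j) - f (Un i)) ⬝ᵥ c i j|
      ≤ dvisc i j * (kruzEta (k i) (Un i) + kruzEta (k i) (Un j))
        - (kruzQ f (k i) (Un j) - kruzQ f (k i) (Un i)) ⬝ᵥ c i j := by
    intro j
    rcases eq_or_ne (c i j) 0 with hc | hc
    · simp [hdvisc j, hc]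
    · have hle : lam i j * l2norm (c i j) ≤ dvisc i j := by
        rw [hdvisc j, if_neg hc]
        exact le_max_left _ _
      have hnorm : 0 ≤ l2norm (c i j) := Real.sqrt_nonneg _
      have hpos : 0 ≤ lam i j := hlam i j ▸ hlamEps.le.trans (le_max_left _ _)
      refine abs_bar_state_le_of_lamK_mul_le f (k i) hc ((mul_nonneg hpos hnorm).trans hle)
        (le_trans ?_ hle)
      rw [hlam i j]
      exact mul_le_mul_of_nonneg_right (le_max_right _ _) hnorm
  have hsum := (Finset.abs_sum_le_sum_abs _ _).trans
    (Finset.sum_le_sum fun j (_ : j ∈ Finset.univ.erase i) => hbar j)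
  have hflux := sum_dotProduct_eq_sum_erase_sub (hcsum i) (fun j => f (Un j)) i
  have hentropy := sum_dotProduct_eq_sum_erase_sub (hcsum i) (fun j => kruzQ f (k i) (Un j)) i
  simp only [dotProduct_comm (c i _)]
  rw [hentropy]
  rw [hflux] at hUnext
  have hvisc : ∑ j ∈ Finset.univ.erase i, dvisc i j * (Un i + Un j - 2 * k i)
      = ∑ j ∈ Finset.univ.erase i, dvisc i j * (Un j - Un i)
        + 2 * (Un i - k i) * ∑ j ∈ Finset.univ.erase i, dvisc i j := by
    rw [Finset.mul_sum, ← Finset.sum_add_distrib]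
    exact Finset.sum_congr rfl fun j _ => by ring
  have hviscEta : ∑ j ∈ Finset.univ.erase i,
        dvisc i j * (kruzEta (k i) (Un i) + kruzEta (k i) (Un j))
      = ∑ j ∈ Finset.univ.erase i, dvisc i j * (kruzEta (k i) (Un j) - kruzEta (k i) (Un i))
        + 2 * kruzEta (k i) (Un i) * ∑ j ∈ Finset.univ.erase i, dvisc i j := by
    rw [Finset.mul_sum, ← Finset.sum_add_distrib]
    exact Finset.sum_congr rfl fun j _ => by ring
  rw [Finset.sum_sub_distrib, Finset.sum_sub_distrib, hvisc, hviscEta] at hsum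
  generalize ∑ j ∈ Finset.univ.erase i, dvisc i j * (Un j - Un i) = V at *
  generalize ∑ j ∈ Finset.univ.erase i,
    dvisc i j * (kruzEta (k i) (Un j) - kruzEta (k i) (Un i)) = W at *
  generalize ∑ j ∈ Finset.univ.erase i, (f (Un j) - f (Un i)) ⬝ᵥ c i j = B at *
  generalize ∑ j ∈ Finset.univ.erase i,
    (kruzQ f (k i) (Un j) - kruzQ f (k i) (Un i)) ⬝ᵥ c i j = Q at *
  generalize ∑ j ∈ Finset.univ.erase i, dvisc i j = S at *
  rw [mul_div_assoc] at hcfl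
  rw [← inv_div τ (mass i)]
  generalize τ / mass i = σ at *
  have hnext : kruzEta (k i) Unext
      ≤ (1 - 2 * σ * S) * kruzEta (k i) (Un i)
        + σ * (W + 2 * kruzEta (k i) (Un i) * S - Q) := by
    have hconvex : Unext - k i
        = (1 - 2 * σ * S) * (Un i - k i) + σ * (V + 2 * (Un i - k i) * S - B) := by
      rw [hUnext]
      ring
    rw [kruzEta, hconvex]
    refine (abs_add_le _ _).trans ?_
    rw [abs_mul, abs_mul, abs_of_nonneg hcfl, abs_of_pos hσ]
    exact add_le_add le_rfl (mul_le_mul_of_nonneg_left hsum hσ.le)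
  have hincr : σ⁻¹ * (kruzEta (k i) Unext - kruzEta (k i) (Un i)) ≤ W - Q := by
    rw [inv_mul_le_iff₀ hσ]
    linarith
  linarith
end
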